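/- Let a, b, c, μ ∈ ℂ with Re c > 0 and Re μ > 0, and assume neither c nor c+μ is a nonpositive integer. Then for every real x ∈ (-∞,0) ∪ (0,1), one has ∫_I |y|^{c-1} (1-y)^{a+b-c} F(a,b;c;y) · |x-y|^{μ-1}/Γ(μ) dy = (Γ(c)/Γ(c+μ)) · |x|^{c+μ-1} (1-x)^{a+b-c+μ} · F(a+μ,b+μ;c+μ;x), where I is the open interval with endpoints 0 and x (fractional integral transformation of type a+, b+, c+, due to Askey and Fitch). -/

import Mathlib

open MeasureTheory Set Complex Filter

/-- Pochhammer symbol `(a)_k = a (a+1) ⋯ (a+k-1)`. -/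
noncomputable def poch (a : ℂ) (k : ℕ) : ℂ := ∏ i ∈ Finset.range k, (a + i)

/-- The Gauss hypergeometric function `F(a,b;c;x)` for real `x < 1`, defined by the
power series on `[0,1)` and by the (agreeing) Pfaff series for `x < 0`. -/
noncomputable def hypF (a b c : ℂ) (x : ℝ) : ℂ :=
  if 0 ≤ x then
    ∑' k : ℕ, poch a k * poch b k / (poch c k * (Nat.factorial k : ℂ)) * (x : ℂ) ^ k
  else
    ((1 - x : ℝ) : ℂ) ^ (-a) *
      ∑' k : ℕ, poch a k * poch (c - b) k / (poch c k * (Nat.factorial k : ℂ)) *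
        (((x / (x - 1) : ℝ)) : ℂ) ^ k

/-- Coefficients of the hypergeometric series. -/
noncomputable def hg (a b c : ℂ) (k : ℕ) : ℂ :=
  poch a k * poch b k / (poch c k * (Nat.factorial k : ℂ))

theorem poch_zero (a : ℂ) : poch a 0 = 1 := by simp [poch]

theorem poch_succ (a : ℂ) (k : ℕ) : poch a (k + 1) = poch a k * (a + k) := by
  simp [poch, Finset.prod_range_succ]

theorem add_nat_ne {c : ℂ} (hc : ∀ n : ℕ, c ≠ -(n : ℂ)) (n : ℕ) : c + n ≠ 0 := by
  intro h
  exact hc n (eq_neg_of_add_eq_zero_left h)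

theorem poch_ne_zero {c : ℂ} (hc : ∀ n : ℕ, c ≠ -(n : ℂ)) (n : ℕ) : poch c n ≠ 0 := by
  rw [poch, Finset.prod_ne_zero_iff]
  intro i _
  exact add_nat_ne hc i

theorem hg_zero (a b c : ℂ) : hg a b c 0 = 1 := by simp [hg, poch_zero]

theorem hg_succ (a b : ℂ) {c : ℂ} (hc : ∀ n : ℕ, c ≠ -(n : ℂ)) (n : ℕ) :
    ((n : ℂ) + 1) * (n + c) * hg a b c (n + 1) = (n + a) * (n + b) * hg a b c n := by
  have h1 := add_nat_ne hc n
  have h2 := poch_ne_zero hc n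
  have h3 : (n : ℂ) + 1 ≠ 0 := by exact_mod_cast Nat.succ_ne_zero n
  have h4 : (Nat.factorial n : ℂ) ≠ 0 := by exact_mod_cast Nat.factorial_ne_zero n
  have h5 : (n : ℂ) + c ≠ 0 := by rwa [add_comm]
  simp only [hg, poch_succ, Nat.factorial_succ]
  push_cast
  rw [add_comm c (n : ℂ)]
  field_simp
  ring

theorem one_ne_neg_nat (n : ℕ) : (1 : ℂ) ≠ -(n : ℂ) := by
  intro h
  have : ((1 + n : ℕ) : ℂ) = 0 := by push_cast; rw [h]; ring
  exact absurd (Nat.cast_eq_zero.mp this) (by omega)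

/-- The Euler operator `x d/dx`. -/
noncomputable def eulerOp (f : PowerSeries ℂ) : PowerSeries ℂ :=
  PowerSeries.X * PowerSeries.derivative ℂ f

theorem coeff_eulerOp (f : PowerSeries ℂ) (n : ℕ) :
    PowerSeries.coeff n (eulerOp f) = n * PowerSeries.coeff n f := by
  cases n with
  | zero => simp [eulerOp]
  | succ n =>
    rw [eulerOp, PowerSeries.coeff_succ_X_mul, PowerSeries.coeff_derivative]
    push_cast
    ring

theorem eulerOp_mul (f g : PowerSeries ℂ) : eulerOp (f * g) = eulerOp f * g + f * eulerOp g := by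
  simp only [eulerOp, Derivation.leibniz, smul_eq_mul]
  ring

theorem eulerOp_add (f g : PowerSeries ℂ) : eulerOp (f + g) = eulerOp f + eulerOp g := by
  simp only [eulerOp, map_add]
  ring

theorem eulerOp_X : eulerOp PowerSeries.X = PowerSeries.X := by
  simp [eulerOp]

theorem eulerOp_C (r : ℂ) : eulerOp (PowerSeries.C r) = 0 := by
  simp [eulerOp]

open PowerSeries in
/-- The hypergeometric differential equation as a formal identity. -/
theorem hg_ode (a b : ℂ) {c : ℂ} (hc : ∀ n : ℕ, c ≠ -(n : ℂ)) :
    eulerOp (eulerOp (PowerSeries.mk (hg a b c))) + C (c - 1) * eulerOp (PowerSeries.mk (hg a b c))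
      = X * (eulerOp (eulerOp (PowerSeries.mk (hg a b c)))
        + C (a + b) * eulerOp (PowerSeries.mk (hg a b c))
        + C (a * b) * PowerSeries.mk (hg a b c)) := by
  ext n
  cases n with
  | zero => simp only [coeff_zero_X_mul, LinearMap.map_add, coeff_C_mul, coeff_eulerOp]; simp
  | succ n =>
    simp only [coeff_succ_X_mul, LinearMap.map_add, coeff_C_mul, coeff_eulerOp, coeff_mk]
    have := hg_succ a b hc n
    push_cast
    linear_combination this

open PowerSeries in
theorem binom_ode (t : ℂ) :
    eulerOp (PowerSeries.mk (hg t 1 1)) =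
      X * (eulerOp (PowerSeries.mk (hg t 1 1)) + C t * PowerSeries.mk (hg t 1 1)) := by
  ext n
  cases n with
  | zero => simp only [coeff_zero_X_mul, LinearMap.map_add, coeff_C_mul, coeff_eulerOp]; simp
  | succ n =>
    simp only [coeff_succ_X_mul, LinearMap.map_add, coeff_C_mul, coeff_eulerOp, coeff_mk]
    have := hg_succ t 1 one_ne_neg_nat n
    have h3 : (n : ℂ) + 1 ≠ 0 := by exact_mod_cast Nat.succ_ne_zero n
    push_cast
    apply mul_left_cancel₀ h3
    linear_combination this

open PowerSeries in
theorem binom_ode2 (t : ℂ) :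
    eulerOp (eulerOp (PowerSeries.mk (hg t 1 1))) =
      X * (eulerOp (PowerSeries.mk (hg t 1 1)) + C t * PowerSeries.mk (hg t 1 1)) +
      X * (eulerOp (eulerOp (PowerSeries.mk (hg t 1 1)))
        + C t * eulerOp (PowerSeries.mk (hg t 1 1))) := by
  have h := congrArg eulerOp (binom_ode t)
  rw [eulerOp_mul, eulerOp_add, eulerOp_mul, eulerOp_C, eulerOp_X] at h
  linear_combination h

/-- Coefficients of `(1-x)^(-t) F(a,b;c;x)`. -/
noncomputable def tw (t a b c : ℂ) (n : ℕ) : ℂ :=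
  PowerSeries.coeff n (PowerSeries.mk (hg t 1 1) * PowerSeries.mk (hg a b c))

theorem tw_zero (t a b c : ℂ) : tw t a b c 0 = 1 := by
  simp [tw, PowerSeries.coeff_mul, hg_zero]

open PowerSeries in
/-- Euler transformation on coefficients (Pfaff-Saalschütz). -/
theorem saal (a b : ℂ) {c : ℂ} (hc : ∀ n : ℕ, c ≠ -(n : ℂ)) (n : ℕ) :
    tw (c - a - b) a b c n = hg (c - a) (c - b) c n := by
  have key : eulerOp (eulerOp (PowerSeries.mk (tw (c - a - b) a b c)))
      + C (c - 1) * eulerOp (PowerSeries.mk (tw (c - a - b) a b c))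
      = X * (eulerOp (eulerOp (PowerSeries.mk (tw (c - a - b) a b c)))
        + C (c - a + (c - b)) * eulerOp (PowerSeries.mk (tw (c - a - b) a b c))
        + C ((c - a) * (c - b)) * PowerSeries.mk (tw (c - a - b) a b c)) := by
    have e : PowerSeries.mk (tw (c - a - b) a b c) =
        PowerSeries.mk (hg (c - a - b) 1 1) * PowerSeries.mk (hg a b c) := by
      ext n; simp [tw]
    rw [e]
    have h1 := hg_ode a b hc
    have h2 := binom_ode (c - a - b)
    have h3 := binom_ode2 (c - a - b)
    simp only [eulerOp_mul, eulerOp_add]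
    simp only [map_add, map_sub, map_mul, map_one] at *
    generalize PowerSeries.mk (hg (c - a - b) 1 1) = P at *
    generalize PowerSeries.mk (hg a b c) = F at *
    generalize eulerOp (eulerOp P) = P2 at *
    generalize eulerOp P = P1 at *
    generalize eulerOp (eulerOp F) = F2 at *
    generalize eulerOp F = F1 at *
    linear_combination P * h1 + (2 * F1 + (C c - 1) * F) * h2 + F * h3
  induction n with
  | zero => rw [tw_zero, hg_zero]
  | succ n ih =>
    have h := congrArg (coeff (n + 1)) key
    simp only [coeff_succ_X_mul, LinearMap.map_add, coeff_C_mul, coeff_eulerOp, coeff_mk] at h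
    have h' := hg_succ (c - a) (c - b) hc n
    have h1 := add_nat_ne hc n
    have h3 : (n : ℂ) + 1 ≠ 0 := by exact_mod_cast Nat.succ_ne_zero n
    apply mul_left_cancel₀ (mul_ne_zero h3 h1)
    push_cast at h
    rw [ih] at h
    linear_combination h - h'

open PowerSeries in
theorem tw_ode (t a b : ℂ) {c : ℂ} (hc : ∀ n : ℕ, c ≠ -(n : ℂ)) :
    eulerOp (eulerOp (PowerSeries.mk (tw t a b c)))
      + C (c - 1) * eulerOp (PowerSeries.mk (tw t a b c))
      = X * (C 2 * eulerOp (eulerOp (PowerSeries.mk (tw t a b c)))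
        + C (2 * t + a + b + c - 1) * eulerOp (PowerSeries.mk (tw t a b c))
        + C (t * c + a * b) * PowerSeries.mk (tw t a b c))
        - X * (X * (eulerOp (eulerOp (PowerSeries.mk (tw t a b c)))
        + C (2 * t + a + b) * eulerOp (PowerSeries.mk (tw t a b c))
        + C ((a + t) * (b + t)) * PowerSeries.mk (tw t a b c))) := by
  have e : PowerSeries.mk (tw t a b c) =
      PowerSeries.mk (hg t 1 1) * PowerSeries.mk (hg a b c) := by
    ext n; simp [tw]
  rw [e]
  have h1 := hg_ode a b hc
  have h2 := binom_ode t
  have h3 := binom_ode2 t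
  simp only [eulerOp_mul, eulerOp_add]
  have c2 : (C (2 : ℂ) : PowerSeries ℂ) = 2 := map_ofNat C 2
  simp only [c2, map_add, map_sub, map_mul, map_one] at h1 h2 h3 ⊢
  generalize PowerSeries.mk (hg t 1 1) = P at *
  generalize PowerSeries.mk (hg a b c) = F at *
  generalize eulerOp (eulerOp P) = P2 at *
  generalize eulerOp P = P1 at *
  generalize eulerOp (eulerOp F) = F2 at *
  generalize eulerOp F = F1 at *
  linear_combination (1 - X) * P * h1 +
    ((2 * F1 + (C c - 1) * F) * (1 - X) + (X - C t * X + X * (1 - C a - C b)) * F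
      + (C c - 2) * F * X) * h2 + F * (1 - X) * h3

open PowerSeries in
theorem tw_one (t a b : ℂ) {c : ℂ} (hc : ∀ n : ℕ, c ≠ -(n : ℂ)) :
    c * tw t a b c 1 = t * c + a * b := by
  have h := congrArg (coeff (0 + 1)) (tw_ode t a b hc)
  simp only [coeff_succ_X_mul, coeff_zero_X_mul, LinearMap.map_add, LinearMap.map_sub,
    coeff_C_mul, coeff_eulerOp, coeff_mk] at h
  rw [tw_zero] at h
  simp only [zero_add] at h
  push_cast at h
  linear_combination h

open PowerSeries in
theorem tw_rec (t a b : ℂ) {c : ℂ} (hc : ∀ n : ℕ, c ≠ -(n : ℂ)) (n : ℕ) :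
    ((n : ℂ) + 2) * (n + 1 + c) * tw t a b c (n + 2) =
      (2 * ((n : ℂ) + 1) ^ 2 + (2 * t + a + b + c - 1) * (n + 1) + (t * c + a * b))
        * tw t a b c (n + 1)
      - (n + a + t) * (n + b + t) * tw t a b c n := by
  have h := congrArg (coeff (n + 1 + 1)) (tw_ode t a b hc)
  simp only [coeff_succ_X_mul, LinearMap.map_add, LinearMap.map_sub,
    coeff_C_mul, coeff_eulerOp, coeff_mk] at h
  push_cast at h
  rw [show n + 1 + 1 = n + 2 from rfl] at h
  linear_combination h

/-- The coefficient identity behind the case `x < 0`. -/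
theorem tw_shift (a B : ℂ) {c μ : ℂ} (hc : ∀ n : ℕ, c ≠ -(n : ℂ))
    (hcμ : ∀ n : ℕ, c + μ ≠ -(n : ℂ)) (n : ℕ) :
    tw (c + μ - B) a B c n * poch c n =
      tw (c - B) (a + μ) B (c + μ) n * poch (c + μ) n := by
  induction n using Nat.twoStepInduction with
  | zero => simp [tw_zero, poch_zero]
  | one =>
    have h1 := tw_one (c + μ - B) a B hc
    have h2 := tw_one (c - B) (a + μ) B hcμ
    rw [show (1 : ℕ) = 0 + 1 from rfl] at *
    simp only [poch_succ, poch_zero]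
    push_cast
    linear_combination h1 - h2
  | more n ih0 ih1 =>
    have h1 := tw_rec (c + μ - B) a B hc n
    have h2 := tw_rec (c - B) (a + μ) B hcμ n
    have h3 : (n : ℂ) + 2 ≠ 0 := by exact_mod_cast Nat.succ_ne_zero (n + 1)
    rw [poch_succ, poch_succ] at ih1
    rw [show n + 2 = n + 1 + 1 from rfl] at *
    simp only [poch_succ]
    push_cast
    apply mul_left_cancel₀ h3
    rw [show n + 1 + 1 = n + 2 from rfl] at *
    generalize tw (c + μ - B) a B c (n + 2) = x2 at *
    generalize tw (c + μ - B) a B c (n + 1) = x1 at *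
    generalize tw (c + μ - B) a B c n = x0 at *
    generalize tw (c - B) (a + μ) B (c + μ) (n + 2) = y2 at *
    generalize tw (c - B) (a + μ) B (c + μ) (n + 1) = y1 at *
    generalize tw (c - B) (a + μ) B (c + μ) n = y0 at *
    generalize poch c n = p at *
    generalize poch (c + μ) n = q at *
    linear_combination p * (c + n) * h1 - q * (c + μ + n) * h2
      + (2 * ((n : ℂ) + 1) ^ 2 + (2 * (c + μ - B) + a + B + c - 1) * (n + 1)
        + ((c + μ - B) * c + a * B)) * ih1
      - (n + a + (c + μ - B)) * (n + c + μ) * (c + n) * ih0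

theorem tendsto_ratio (a c : ℂ) :
    Tendsto (fun n : ℕ => ((n : ℂ) + a) / (n + c)) atTop (nhds 1) := by
  have h1 : Tendsto (fun n : ℕ => (1 + a * (n : ℂ)⁻¹) / (1 + c * (n : ℂ)⁻¹)) atTop
      (nhds ((1 + a * 0) / (1 + c * 0))) := by
    have h0 : Tendsto (fun n : ℕ => (n : ℂ)⁻¹) atTop (nhds 0) :=
      tendsto_inv_atTop_nhds_zero_nat (𝕜 := ℂ)
    exact ((h0.const_mul a).const_add 1).div ((h0.const_mul c).const_add 1) (by simp)
  simp only [mul_zero, add_zero, div_one] at h1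
  refine h1.congr' ?_
  filter_upwards [eventually_gt_atTop 0] with n hn
  have : (n : ℂ) ≠ 0 := by exact_mod_cast hn.ne'
  rw [← mul_div_mul_left _ _ this]
  congr 1 <;> field_simp

theorem hg_summable (a b : ℂ) {c : ℂ} (hc : ∀ n : ℕ, c ≠ -(n : ℂ)) {z : ℝ} (hz0 : 0 ≤ z)
    (hz1 : z < 1) : Summable fun n => ‖hg a b c n * (z : ℂ) ^ n‖ := by
  obtain ⟨r, hr1, hr2⟩ := exists_between hz1
  have hlim : Tendsto (fun n : ℕ => ‖((n : ℂ) + a) / (n + 1) * (((n : ℂ) + b) / (n + c)) * z‖)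
      atTop (nhds ‖(1 : ℂ) * 1 * z‖) :=
    (((tendsto_ratio a 1).mul (tendsto_ratio b c)).mul_const _).norm
  have hl : ‖(1 : ℂ) * 1 * z‖ < r := by simpa [abs_of_nonneg hz0] using hr1
  have := summable_of_ratio_norm_eventually_le (f := fun n => ‖hg a b c n * (z : ℂ) ^ n‖) hr2 ?_
  · exact this
  · filter_upwards [hlim.eventually_le_const hl] with n hn
    have h := hg_succ a b hc n
    have h1 : (n : ℂ) + c ≠ 0 := by rw [add_comm]; exact add_nat_ne hc n
    have h3 : (n : ℂ) + 1 ≠ 0 := by exact_mod_cast Nat.succ_ne_zero n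
    have e : hg a b c (n + 1) * (z : ℂ) ^ (n + 1) =
        (((n : ℂ) + a) / (n + 1) * (((n : ℂ) + b) / (n + c)) * z) * (hg a b c n * (z : ℂ) ^ n) := by
      have : hg a b c (n + 1) = ((n : ℂ) + a) / (n + 1) * (((n : ℂ) + b) / (n + c)) * hg a b c n := by
        field_simp
        linear_combination h
      rw [this]; ring
    rw [norm_norm, norm_norm, e, norm_mul]
    gcongr

theorem choose_eq (t : ℂ) (n : ℕ) : Ring.choose (t + n - 1) n = hg t 1 1 n := by
  have h4 : (Nat.factorial n : ℂ) ≠ 0 := by exact_mod_cast Nat.factorial_ne_zero n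
  have h5 := poch_ne_zero one_ne_neg_nat n
  have : hg t 1 1 n = poch t n / Nat.factorial n := by
    rw [hg]; field_simp
  rw [this, eq_div_iff h4, mul_comm, ← nsmul_eq_mul, ← Ring.descPochhammer_eq_factorial_smul_choose,
    Polynomial.descPochhammer_smeval_eq_ascPochhammer, Polynomial.ascPochhammer_smeval_cast,
    Polynomial.ascPochhammer_smeval_eq_eval]
  rw [show t + n - 1 - n + 1 = t by ring]
  clear this h4 h5
  induction n with
  | zero => simp [poch_zero]
  | succ n ih => rw [ascPochhammer_succ_eval, poch_succ, ih]

theorem binom_sum (t : ℂ) {z : ℝ} (hz0 : 0 ≤ z) (hz1 : z < 1) :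
    ((1 - z : ℝ) : ℂ) ^ (-t) = ∑' n, hg t 1 1 n * (z : ℂ) ^ n := by
  have h := Complex.one_div_one_sub_cpow_hasFPowerSeriesOnBall_zero t
  have hs := h.hasSum (y := (z : ℂ)) (by
    simp [enorm_eq_nnnorm]
    rw [← NNReal.coe_lt_coe]; simpa [abs_of_nonneg hz0] using hz1)
  simp only [FormalMultilinearSeries.ofScalars_apply_eq, zero_add, choose_eq, smul_eq_mul] at hs
  rw [hs.tsum_eq, Complex.cpow_neg, one_div]
  push_cast
  rfl

theorem tw_conv (t a b c : ℂ) (z : ℂ) (n : ℕ) :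
    ∑ kl ∈ Finset.HasAntidiagonal.antidiagonal n, (hg t 1 1 kl.1 * z ^ kl.1) * (hg a b c kl.2 * z ^ kl.2)
      = tw t a b c n * z ^ n := by
  rw [tw, PowerSeries.coeff_mul, Finset.sum_mul]
  refine Finset.sum_congr rfl fun kl hkl => ?_
  rw [← Finset.HasAntidiagonal.mem_antidiagonal.mp hkl, PowerSeries.coeff_mk, PowerSeries.coeff_mk, pow_add]
  ring

theorem tw_summable (t a b : ℂ) {c : ℂ} (hc : ∀ n : ℕ, c ≠ -(n : ℂ)) {z : ℝ} (hz0 : 0 ≤ z)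
    (hz1 : z < 1) : Summable fun n => ‖tw t a b c n * (z : ℂ) ^ n‖ := by
  have := summable_norm_sum_mul_antidiagonal_of_summable_norm
    (hg_summable t 1 one_ne_neg_nat hz0 hz1) (hg_summable a b hc hz0 hz1)
  simpa only [tw_conv] using this

theorem tw_sum (t a b : ℂ) {c : ℂ} (hc : ∀ n : ℕ, c ≠ -(n : ℂ)) {z : ℝ} (hz0 : 0 ≤ z)
    (hz1 : z < 1) : ((1 - z : ℝ) : ℂ) ^ (-t) * ∑' n, hg a b c n * (z : ℂ) ^ n
      = ∑' n, tw t a b c n * (z : ℂ) ^ n := by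
  rw [binom_sum t hz0 hz1, tsum_mul_tsum_eq_tsum_sum_antidiagonal_of_summable_norm
    (hg_summable t 1 one_ne_neg_nat hz0 hz1) (hg_summable a b hc hz0 hz1)]
  simp only [tw_conv]

theorem Gamma_add_nat {c : ℂ} (hc : ∀ n : ℕ, c ≠ -(n : ℂ)) (n : ℕ) :
    Complex.Gamma (c + n) = poch c n * Complex.Gamma c := by
  induction n with
  | zero => simp [poch_zero]
  | succ n ih =>
    push_cast
    rw [← add_assoc, Complex.Gamma_add_one _ (add_nat_ne hc n), ih, poch_succ]
    ring

theorem beta_integrable {c μ : ℂ} (hc : 0 < c.re) (hμ : 0 < μ.re) {w : ℝ} (hw : 0 < w) :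
    IntegrableOn (fun z : ℝ => (z : ℂ) ^ (c - 1) * ((w - z : ℝ) : ℂ) ^ (μ - 1)) (Ioo 0 w) := by
  have h := (Complex.betaIntegral_convergent hc hμ).comp_mul_left (c := w⁻¹)
  have h2 : IntervalIntegrable (fun z : ℝ => (w : ℂ) ^ (c - 1) * (w : ℂ) ^ (μ - 1) *
      (((w⁻¹ * z : ℝ) : ℂ) ^ (c - 1) * (1 - ((w⁻¹ * z : ℝ) : ℂ)) ^ (μ - 1))) volume 0 w := by
    have := h.const_mul ((w : ℂ) ^ (c - 1) * (w : ℂ) ^ (μ - 1))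
    simpa using this
  rw [intervalIntegrable_iff_integrableOn_Ioo_of_le hw.le] at h2
  refine h2.congr_fun ?_ measurableSet_Ioo
  intro z hz
  have h3 : (1 : ℂ) - ((w⁻¹ * z : ℝ) : ℂ) = ((1 - w⁻¹ * z : ℝ) : ℂ) := by push_cast; rfl
  have h4 : 0 ≤ 1 - w⁻¹ * z := by
    have : w⁻¹ * z ≤ w⁻¹ * w := by gcongr; exact hz.2.le
    rw [inv_mul_cancel₀ hw.ne'] at this
    linarith
  have h5 : 0 ≤ w⁻¹ * z := mul_nonneg (inv_nonneg.mpr hw.le) hz.1.le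
  simp only
  rw [h3, mul_mul_mul_comm, ← Complex.mul_cpow_ofReal_nonneg hw.le h5,
    ← Complex.mul_cpow_ofReal_nonneg hw.le h4, ← Complex.ofReal_mul, ← Complex.ofReal_mul]
  congr 4
  · field_simp
  · field_simp

theorem beta_eval {c μ : ℂ} (hc : 0 < c.re) (hμ : 0 < μ.re)
    (hc1 : ∀ n : ℕ, c ≠ -(n : ℂ)) (hc2 : ∀ n : ℕ, c + μ ≠ -(n : ℂ)) {w : ℝ} (hw : 0 < w) (n : ℕ) :
    ∫ z in Ioo 0 w, (z : ℂ) ^ (c - 1) * ((w - z : ℝ) : ℂ) ^ (μ - 1) * (z : ℂ) ^ n =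
      Complex.Gamma c * Complex.Gamma μ / Complex.Gamma (c + μ) * (w : ℂ) ^ (c + μ - 1) *
        (poch c n / poch (c + μ) n * (w : ℂ) ^ n) := by
  have hw' : (w : ℂ) ≠ 0 := by exact_mod_cast hw.ne'
  have hcn : 0 < (c + n).re := by simp; positivity
  have h := Complex.betaIntegral_scaled (c + n) μ hw
  rw [intervalIntegral.integral_of_le hw.le, integral_Ioc_eq_integral_Ioo] at h
  have hg := Complex.Gamma_mul_Gamma_eq_betaIntegral hcn hμ
  have hcm : 0 < (c + μ).re := by simp; positivity
  have hG := Complex.Gamma_ne_zero_of_re_pos hcm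
  have hp := poch_ne_zero hc2 n
  rw [show c + n + μ = c + μ + n by ring, Gamma_add_nat hc1, Gamma_add_nat hc2] at hg
  have hb : Complex.betaIntegral (c + n) μ = Complex.Gamma c * Complex.Gamma μ /
      Complex.Gamma (c + μ) * (poch c n / poch (c + μ) n) := by
    field_simp
    linear_combination -hg
  rw [hb, show c + n + μ - 1 = c + μ - 1 + n by ring, Complex.cpow_add _ _ hw',
    Complex.cpow_natCast] at h
  trans ∫ z in Ioo 0 w, (z : ℂ) ^ (c + n - 1) * ((w : ℂ) - z) ^ (μ - 1)
  · refine setIntegral_congr_fun measurableSet_Ioo fun z hz => ?_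
    have hz' : (z : ℂ) ≠ 0 := by exact_mod_cast hz.1.ne'
    rw [show c + n - 1 = c - 1 + n by ring, Complex.cpow_add _ _ hz', Complex.cpow_natCast]
    push_cast
    ring
  · rw [h]; ring

/-- Termwise fractional integration of a power series. -/
theorem master {c μ : ℂ} (hc : 0 < c.re) (hμ : 0 < μ.re)
    (hc1 : ∀ n : ℕ, c ≠ -(n : ℂ)) (hc2 : ∀ n : ℕ, c + μ ≠ -(n : ℂ)) {w : ℝ} (hw : 0 < w)
    (e : ℕ → ℂ) (he : Summable fun n => ‖e n * (w : ℂ) ^ n‖) :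
    ∫ z in Ioo 0 w, (z : ℂ) ^ (c - 1) * ((w - z : ℝ) : ℂ) ^ (μ - 1) * ∑' n, e n * (z : ℂ) ^ n =
      Complex.Gamma c * Complex.Gamma μ / Complex.Gamma (c + μ) * (w : ℂ) ^ (c + μ - 1) *
        ∑' n, e n * (poch c n / poch (c + μ) n) * (w : ℂ) ^ n := by
  set K : ℝ → ℂ := fun z => (z : ℂ) ^ (c - 1) * ((w - z : ℝ) : ℂ) ^ (μ - 1) with hK
  have hKi : IntegrableOn K (Ioo 0 w) := beta_integrable hc hμ hw
  have hbd : ∀ n, ∀ z ∈ Ioo 0 w, ‖e n * (z : ℂ) ^ n‖ ≤ ‖e n * (w : ℂ) ^ n‖ := by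
    intro n z hz
    simp only [norm_mul, norm_pow, Complex.norm_real, Real.norm_eq_abs, abs_of_pos hz.1,
      abs_of_pos hw]
    have := hz.1.le
    have := hz.2.le
    gcongr
  have hint : ∀ n, Integrable (fun z : ℝ => K z * (e n * (z : ℂ) ^ n)) (volume.restrict (Ioo 0 w)) := by
    intro n
    refine Integrable.mul_bdd (c := ‖e n * (w : ℂ) ^ n‖) hKi ?_ ?_
    · exact (Continuous.aestronglyMeasurable (by fun_prop))
    · exact (ae_restrict_iff' measurableSet_Ioo).mpr (ae_of_all _ (hbd n))
  have hsum : Summable fun n => ∫ z in Ioo 0 w, ‖K z * (e n * (z : ℂ) ^ n)‖ := by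
    refine Summable.of_nonneg_of_le (fun n => integral_nonneg fun _ => norm_nonneg _) (fun n => ?_)
      (he.mul_left (∫ z in Ioo 0 w, ‖K z‖))
    rw [← integral_mul_const]
    refine setIntegral_mono_on (hint n).norm (hKi.norm.mul_const _) measurableSet_Ioo fun z hz => ?_
    rw [norm_mul]
    gcongr
    exact hbd n z hz
  have h := hasSum_integral_of_summable_integral_norm hint hsum
  simp only [tsum_mul_left] at h
  rw [← h.tsum_eq, ← tsum_mul_left]
  refine tsum_congr fun n => ?_
  have := beta_eval hc hμ hc1 hc2 hw n
  trans e n * ∫ z in Ioo 0 w, (z : ℂ) ^ (c - 1) * ((w - z : ℝ) : ℂ) ^ (μ - 1) * (z : ℂ) ^ n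
  · rw [← integral_const_mul]
    congr 1
    ext z
    simp only [hK]
    ring
  · rw [this]; ring

theorem hypF_pos (a b c : ℂ) {x : ℝ} (hx : 0 ≤ x) :
    hypF a b c x = ∑' n, hg a b c n * (x : ℂ) ^ n := by
  rw [hypF, if_pos hx]; rfl

theorem hypF_neg (a b c : ℂ) {x : ℝ} (hx : x < 0) :
    hypF a b c x = ((1 - x : ℝ) : ℂ) ^ (-a) *
      ∑' n, hg a (c - b) c n * ((x / (x - 1) : ℝ) : ℂ) ^ n := by
  rw [hypF, if_neg (not_le.mpr hx)]; rfl

theorem case_pos (a b c μ : ℂ) (hc : 0 < c.re) (hμ : 0 < μ.re)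
    (hc1 : ∀ n : ℕ, c ≠ -(n : ℂ)) (hc2 : ∀ n : ℕ, c + μ ≠ -(n : ℂ))
    (x : ℝ) (hx0 : 0 < x) (hx1 : x < 1) :
    ∫ y in uIoo 0 x,
        ((|y| : ℝ) : ℂ) ^ (c - 1) * ((1 - y : ℝ) : ℂ) ^ (a + b - c) * hypF a b c y *
          (((|x - y| : ℝ) : ℂ) ^ (μ - 1) / Complex.Gamma μ)
      = Complex.Gamma c / Complex.Gamma (c + μ) * ((|x| : ℝ) : ℂ) ^ (c + μ - 1) *
        ((1 - x : ℝ) : ℂ) ^ (a + b - c + μ) * hypF (a + μ) (b + μ) (c + μ) x := by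
  have hΓ := Complex.Gamma_ne_zero_of_re_pos hμ
  rw [uIoo_of_le hx0.le]
  have m := master hc hμ hc1 hc2 hx0 (tw (c - a - b) a b c) (tw_summable _ _ _ hc1 hx0.le hx1)
  trans (Complex.Gamma μ)⁻¹ * ∫ z in Ioo 0 x, (z : ℂ) ^ (c - 1) * ((x - z : ℝ) : ℂ) ^ (μ - 1) *
      ∑' n, tw (c - a - b) a b c n * (z : ℂ) ^ n
  · rw [← integral_const_mul]
    refine setIntegral_congr_fun measurableSet_Ioo fun y hy => ?_
    rw [← tw_sum _ _ _ hc1 hy.1.le (hy.2.trans hx1), hypF_pos _ _ _ hy.1.le, abs_of_pos hy.1,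
      abs_of_pos (sub_pos.mpr hy.2), show -(c - a - b) = a + b - c by ring]
    ring
  · rw [m, hypF_pos _ _ _ hx0.le, abs_of_pos hx0]
    have h2 := tw_sum ((c + μ) - (a + μ) - (b + μ)) (a + μ) (b + μ) hc2 hx0.le hx1
    rw [show -((c + μ) - (a + μ) - (b + μ)) = a + b - c + μ by ring] at h2
    rw [mul_assoc (_ / _ * _), h2]
    have : ∀ n, tw (c - a - b) a b c n * (poch c n / poch (c + μ) n) =
        tw ((c + μ) - (a + μ) - (b + μ)) (a + μ) (b + μ) (c + μ) n := by
      intro n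
      rw [saal _ _ hc1, saal _ _ hc2, hg, hg]
      have h1 := poch_ne_zero hc1 n
      have h2 := poch_ne_zero hc2 n
      rw [show c + μ - (a + μ) = c - a by ring, show c + μ - (b + μ) = c - b by ring]
      field_simp
    simp only [this]
    field_simp

theorem cpow_div_real {p q : ℝ} (hp : 0 ≤ p) (hq : 0 < q) (s : ℂ) :
    ((p / q : ℝ) : ℂ) ^ s = (p : ℂ) ^ s * (q : ℂ) ^ (-s) := by
  rw [Complex.ofReal_div, Complex.div_cpow_ofReal_nonneg hp hq.le, Complex.cpow_neg, div_eq_mul_inv]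

theorem cpow_one_div_real {q : ℝ} (hq : 0 < q) (s : ℂ) :
    ((1 / q : ℝ) : ℂ) ^ s = (q : ℂ) ^ (-s) := by
  rw [cpow_div_real zero_le_one hq]; simp

theorem case_neg (a b c μ : ℂ) (hc : 0 < c.re) (hμ : 0 < μ.re)
    (hc1 : ∀ n : ℕ, c ≠ -(n : ℂ)) (hc2 : ∀ n : ℕ, c + μ ≠ -(n : ℂ))
    (x : ℝ) (hx : x < 0) :
    ∫ y in uIoo 0 x,
        ((|y| : ℝ) : ℂ) ^ (c - 1) * ((1 - y : ℝ) : ℂ) ^ (a + b - c) * hypF a b c y *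
          (((|x - y| : ℝ) : ℂ) ^ (μ - 1) / Complex.Gamma μ)
      = Complex.Gamma c / Complex.Gamma (c + μ) * ((|x| : ℝ) : ℂ) ^ (c + μ - 1) *
        ((1 - x : ℝ) : ℂ) ^ (a + b - c + μ) * hypF (a + μ) (b + μ) (c + μ) x := by
  have hΓ := Complex.Gamma_ne_zero_of_re_pos hμ
  rw [uIoo_of_ge hx.le]
  obtain ⟨w, hw⟩ : ∃ w, w = x / (x - 1) := ⟨_, rfl⟩
  have hx1 : x - 1 < 0 := by linarith
  have hw0 : 0 < w := hw ▸ div_pos_of_neg_of_neg hx hx1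
  have hw1 : w < 1 := by rw [hw, div_lt_one_of_neg hx1]; linarith
  have hv : 0 < 1 - w := by linarith
  have hxw : x = w / (w - 1) := by
    have h1 : x - 1 ≠ 0 := hx1.ne
    have h2 : w - 1 ≠ 0 := by linarith
    rw [eq_div_iff h2, hw]; field_simp; ring
  have himg : (fun z : ℝ => z / (z - 1)) '' Ioo 0 w = Ioo x 0 := by
    ext y
    constructor
    · rintro ⟨z, ⟨hz0, hzw⟩, rfl⟩
      have hz1 : z - 1 < 0 := by linarith
      refine ⟨?_, div_neg_of_pos_of_neg hz0 hz1⟩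
      simp only
      rw [lt_div_iff_of_neg hz1, hxw, ← sub_pos]
      have : w / (w - 1) * (z - 1) - z = (w - z) / (1 - w) := by
        have h2 : w - 1 ≠ 0 := by linarith
        have h3 : 1 - w ≠ 0 := hv.ne'
        rw [div_mul_eq_mul_div, div_sub' h2, div_eq_div_iff h2 h3]
        ring
      rw [this]
      exact div_pos (by linarith) hv
    · rintro ⟨hy0, hy1⟩
      have hy2 : y - 1 < 0 := by linarith
      refine ⟨y / (y - 1), ⟨div_pos_of_neg_of_neg hy1 hy2, ?_⟩, ?_⟩
      · rw [hw, ← sub_pos]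
        have : x / (x - 1) - y / (y - 1) = (y - x) / ((x - 1) * (y - 1)) := by
          have h2 : y - 1 ≠ 0 := hy2.ne
          have h3 : x - 1 ≠ 0 := hx1.ne
          field_simp; ring
        rw [this]
        exact div_pos (by linarith) (mul_pos_of_neg_of_neg hx1 hy2)
      · have h2 : y - 1 ≠ 0 := hy2.ne
        have h3 : y / (y - 1) - 1 = 1 / (y - 1) := by field_simp; ring
        simp only
        rw [h3]; field_simp
  have hder : ∀ z ∈ Ioo 0 w, HasDerivWithinAt (fun z : ℝ => z / (z - 1)) (-1 / (z - 1) ^ 2)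
      (Ioo 0 w) z := by
    intro z hz
    have h2 : z - 1 ≠ 0 := by linarith [hz.2]
    have := ((hasDerivAt_id z).div ((hasDerivAt_id z).sub_const 1) h2).hasDerivWithinAt (s := Ioo 0 w)
    have e : (1 * (z - 1) - z * 1) / (z - 1) ^ 2 = -1 / (z - 1) ^ 2 := by
      congr 1; ring
    rw [← e]
    exact this
  have hinj : InjOn (fun z : ℝ => z / (z - 1)) (Ioo 0 w) := by
    intro z hz z' hz' h
    have h2 : z - 1 ≠ 0 := by linarith [hz.2]
    have h3 : z' - 1 ≠ 0 := by linarith [hz'.2]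
    have h : z / (z - 1) = z' / (z' - 1) := h
    rw [div_eq_div_iff h2 h3] at h
    linarith
  rw [← himg, integral_image_eq_integral_abs_deriv_smul measurableSet_Ioo hder hinj]
  have hv' : ((1 - w : ℝ) : ℂ) ≠ 0 := by exact_mod_cast hv.ne'
  have m := master hc hμ hc1 hc2 hw0 (tw (c + μ - (c - b)) a (c - b) c)
    (tw_summable _ _ _ hc1 hw0.le hw1)
  trans (Complex.Gamma μ)⁻¹ * ((1 - w : ℝ) : ℂ) ^ (-(μ - 1)) *
      ∫ z in Ioo 0 w, (z : ℂ) ^ (c - 1) * ((w - z : ℝ) : ℂ) ^ (μ - 1) *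
      ∑' n, tw (c + μ - (c - b)) a (c - b) c n * (z : ℂ) ^ n
  · rw [← integral_const_mul]
    refine setIntegral_congr_fun measurableSet_Ioo fun z hz => ?_
    have hz0 := hz.1
    have hu : 0 < 1 - z := by linarith [hz.2]
    have hu' : ((1 - z : ℝ) : ℂ) ≠ 0 := by exact_mod_cast hu.ne'
    have h2 : z - 1 ≠ 0 := by linarith
    have h3 : w - 1 ≠ 0 := by linarith
    have hu0 := hu.ne'
    have hv0 := hv.ne'
    have hyneg : z / (z - 1) < 0 := div_neg_of_pos_of_neg hz0 (by linarith)
    have e1 : |z / (z - 1)| = z / (1 - z) := by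
      rw [abs_of_neg hyneg, ← div_neg, neg_sub]
    have e2 : 1 - z / (z - 1) = 1 / (1 - z) := by
      rw [eq_div_iff hu0]; field_simp; ring
    have e3 : z / (z - 1) / (z / (z - 1) - 1) = z := by
      have : z / (z - 1) - 1 = 1 / (z - 1) := by field_simp; ring
      rw [this]; field_simp
    have e4 : |x - z / (z - 1)| = (w - z) / ((1 - w) * (1 - z)) := by
      have : x - z / (z - 1) = -((w - z) / ((1 - w) * (1 - z))) := by
        rw [hxw, div_sub_div _ _ h3 h2, ← neg_div, div_eq_div_iff (mul_ne_zero h3 h2)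
          (mul_ne_zero hv0 hu0)]
        ring
      rw [this, abs_neg, abs_of_pos]
      exact div_pos (by linarith [hz.2]) (mul_pos hv hu)
    have e5 : |-1 / (z - 1) ^ 2| = 1 / (1 - z) ^ 2 := by
      rw [abs_div, abs_neg, abs_one, abs_of_nonneg (sq_nonneg _), ← neg_sub 1 z, neg_sq]
    have e6 : ((1 / (1 - z) ^ 2 : ℝ) : ℂ) = ((1 - z : ℝ) : ℂ) ^ (-2 : ℂ) := by
      rw [Complex.cpow_neg, Complex.cpow_ofNat]; push_cast; rw [one_div]
    rw [← tw_sum _ _ _ hc1 hz0.le (hz.2.trans hw1), hypF_neg _ _ _ hyneg, e1, e2, e3, e4, e5,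
      Complex.real_smul, e6, cpow_div_real hz0.le hu, cpow_one_div_real hu, cpow_one_div_real hu,
      cpow_div_real (by linarith [hz.2]) (mul_pos hv hu), Complex.ofReal_mul (1 - w),
      Complex.mul_cpow_ofReal_nonneg hv.le hu.le,
      show -(c + μ - (c - b)) = -2 + -(c - 1) + -(a + b - c) + -(-a) + -(μ - 1) by ring,
      Complex.cpow_add _ _ hu', Complex.cpow_add _ _ hu', Complex.cpow_add _ _ hu',
      Complex.cpow_add _ _ hu']
    ring
  · have e1 : |x| = w / (1 - w) := by
      rw [abs_of_neg hx, hxw, ← div_neg, neg_sub]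
    have e2 : 1 - x = 1 / (1 - w) := by
      have h3 : w - 1 ≠ 0 := by linarith
      have hv0 := hv.ne'
      rw [hxw, eq_div_iff hv0]; field_simp; ring
    rw [m, hypF_neg _ _ _ hx, ← hw, e1, e2, cpow_div_real hw0.le hv, cpow_one_div_real hv,
      cpow_one_div_real hv]
    have h2 := tw_sum (c - (c - b)) (a + μ) (c - b) hc2 hw0.le hw1
    have : ∀ n, tw (c + μ - (c - b)) a (c - b) c n * (poch c n / poch (c + μ) n) =
        tw (c - (c - b)) (a + μ) (c - b) (c + μ) n := by
      intro n
      have h1 := poch_ne_zero hc2 n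
      have h2 := tw_shift a (c - b) hc1 hc2 n
      rw [← mul_div_assoc, div_eq_iff h1, h2]
    simp only [this]
    rw [← h2, show c + μ - (b + μ) = c - b by ring]
    have e3 : ((1 - w : ℝ) : ℂ) ^ (-(μ - 1)) * ((1 - w : ℝ) : ℂ) ^ (-(c - (c - b))) =
        ((1 - w : ℝ) : ℂ) ^ (-(c + μ - 1)) * ((1 - w : ℝ) : ℂ) ^ (-(a + b - c + μ)) *
        ((1 - w : ℝ) : ℂ) ^ (-(-(a + μ))) := by
      rw [← Complex.cpow_add _ _ hv', ← Complex.cpow_add _ _ hv', ← Complex.cpow_add _ _ hv']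
      congr 1
      ring
    have hΓ' : (Complex.Gamma μ)⁻¹ * Complex.Gamma μ = 1 := inv_mul_cancel₀ hΓ
    linear_combination (Complex.Gamma c / Complex.Gamma (c + μ) * (w : ℂ) ^ (c + μ - 1) *
      ∑' n, hg (a + μ) (c - b) (c + μ) n * (w : ℂ) ^ n) * e3 +
      (Complex.Gamma c / Complex.Gamma (c + μ) * (w : ℂ) ^ (c + μ - 1) *
      (∑' n, hg (a + μ) (c - b) (c + μ) n * (w : ℂ) ^ n) *
      (((1 - w : ℝ) : ℂ) ^ (-(μ - 1)) * ((1 - w : ℝ) : ℂ) ^ (-(c - (c - b))))) * hΓ'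

/-- Fractional integral transformation of type `a+, b+, c+` (Askey–Fitch). -/
theorem stmt_2 (a b c μ : ℂ) (hc : 0 < c.re) (hμ : 0 < μ.re)
    (hc1 : ∀ n : ℕ, c ≠ -(n : ℂ)) (hc2 : ∀ n : ℕ, c + μ ≠ -(n : ℂ))
    (x : ℝ) (hx : x < 0 ∨ (0 < x ∧ x < 1)) :
    ∫ y in uIoo 0 x,
        ((|y| : ℝ) : ℂ) ^ (c - 1) * ((1 - y : ℝ) : ℂ) ^ (a + b - c) * hypF a b c y *
          (((|x - y| : ℝ) : ℂ) ^ (μ - 1) / Complex.Gamma μ)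
      = Complex.Gamma c / Complex.Gamma (c + μ) * ((|x| : ℝ) : ℂ) ^ (c + μ - 1) *
        ((1 - x : ℝ) : ℂ) ^ (a + b - c + μ) * hypF (a + μ) (b + μ) (c + μ) x := by
  rcases hx with hx | ⟨hx0, hx1⟩
  · exact case_neg a b c μ hc hμ hc1 hc2 x hx
  · exact case_pos a b c μ hc hμ hc1 hc2 x hx0 hx1
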